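/- arXiv:2108.10792 — 4 statements merged into one kernel-verified Lean document; each statement's English description precedes it below -/
import Mathlib

section
/- For every smooth vector field v : ℝ³ → ℝ³ one has RotRot^⊤(sym Grad v) = 0, i.e. the first complex property of the elasticity complex holds on smooth fields. -/
open Matrix

noncomputable section

/-- Points of `ℝ³`. -/
abbrev V3 := Fin 3 → ℝ
/-- Real `3×3` matrices. -/
abbrev M3 := Matrix (Fin 3) (Fin 3) ℝ

/-- Partial derivative `∂ᵢ f` of a scalar function on `ℝ³`. -/
def pd (i : Fin 3) (f : V3 → ℝ) (x : V3) : ℝ := fderiv ℝ f x (Pi.single i 1)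

/-- Gradient of a scalar function. -/
def grad (f : V3 → ℝ) (x : V3) : V3 := fun i => pd i f x

/-- Divergence of a vector field. -/
def vdiv (v : V3 → V3) (x : V3) : ℝ := ∑ i, pd i (fun y => v y i) x

/-- Curl (rotation) of a vector field. -/
def vrot (v : V3 → V3) (x : V3) : V3 :=
  ![pd 1 (fun y => v y 2) x - pd 2 (fun y => v y 1) x,
    pd 2 (fun y => v y 0) x - pd 0 (fun y => v y 2) x,
    pd 0 (fun y => v y 1) x - pd 1 (fun y => v y 0) x]

/-- Jacobian matrix `(Grad v)_{ij} = ∂_j v_i` of a vector field. -/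
def vGrad (v : V3 → V3) (x : V3) : M3 := Matrix.of fun i j => pd j (fun y => v y i) x

/-- Row-wise curl of a matrix field. -/
def mRot (S : V3 → M3) (x : V3) : M3 := Matrix.of fun i => vrot (fun y => S y i) x

/-- Row-wise divergence of a matrix field. -/
def mDiv (S : V3 → M3) (x : V3) : V3 := fun i => vdiv (fun y => S y i) x

/-- The second order operator `RotRot^⊤ S = Rot ((Rot S)ᵀ)`. -/
def rotRotT (S : V3 → M3) (x : V3) : M3 := mRot (fun y => (mRot S y)ᵀ) x

/-- Symmetric part of a matrix. -/
def msym (M : M3) : M3 := (2⁻¹ : ℝ) • (M + Mᵀ)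

/-- Skew-symmetric part of a matrix. -/
def mskw (M : M3) : M3 := (2⁻¹ : ℝ) • (M - Mᵀ)

/-- Deviatoric (trace-free) part of a matrix. -/
def mdev (M : M3) : M3 := M - (Matrix.trace M / 3) • (1 : M3)

/-- The skew-symmetric matrix `spn w` with `(spn w) x = w × x`. -/
def spn (w : V3) : M3 := !![0, -w 2, w 1; w 2, 0, -w 0; -w 1, w 0, 0]

/-- The axial vector of a (skew-symmetric) matrix; inverse of `spn`. -/
def spnInv (M : M3) : V3 := ![M 2 1, M 0 2, M 1 0]

end

theorem ContDiff.pd {f : V3 → ℝ} (hf : ContDiff ℝ (⊤ : ℕ∞) f) (i : Fin 3) :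
    ContDiff ℝ (⊤ : ℕ∞) (pd i f) :=
  (hf.fderiv_right (m := ((⊤ : ℕ∞) : WithTop ℕ∞)) (by simp)).clm_apply contDiff_const

theorem pd_add {f g : V3 → ℝ} (hf : Differentiable ℝ f) (hg : Differentiable ℝ g)
    (i : Fin 3) (x : V3) : pd i (fun y => f y + g y) x = pd i f x + pd i g x := by
  simp only [pd]
  rw [fderiv_fun_add (hf x) (hg x), _root_.add_apply]

theorem pd_sub {f g : V3 → ℝ} (hf : Differentiable ℝ f) (hg : Differentiable ℝ g)
    (i : Fin 3) (x : V3) : pd i (fun y => f y - g y) x = pd i f x - pd i g x := by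
  simp only [pd]
  rw [fderiv_fun_sub (hf x) (hg x), _root_.sub_apply]

theorem pd_const_mul {f : V3 → ℝ} (hf : Differentiable ℝ f) (c : ℝ) (i : Fin 3) (x : V3) :
    pd i (fun y => c * f y) x = c * pd i f x := by
  simp only [pd]
  rw [fderiv_const_mul (hf x) c, _root_.smul_apply, smul_eq_mul]

/-- Partial derivatives of a smooth function commute. -/
theorem pd_comm {f : V3 → ℝ} (hf : ContDiff ℝ (⊤ : ℕ∞) f) (i j : Fin 3) (x : V3) :
    pd i (pd j f) x = pd j (pd i f) x := by
  have hd : DifferentiableAt ℝ (fderiv ℝ f) x :=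
    ((hf.fderiv_right (m := 1) (by norm_cast)).differentiable one_ne_zero) x
  have key (a b : Fin 3) :
      pd a (pd b f) x = fderiv ℝ (fderiv ℝ f) x (Pi.single a 1) (Pi.single b 1) := by
    change fderiv ℝ (fun y => fderiv ℝ f y (Pi.single b 1)) x (Pi.single a 1) = _
    rw [fderiv_clm_apply hd (differentiableAt_const _)]
    simp
  rw [key, key]
  exact (hf.contDiffAt.isSymmSndFDerivAt (by simp; norm_cast)) _ _

/-- The curl of a gradient vanishes. -/
theorem vrot_grad {f : V3 → ℝ} (hf : ContDiff ℝ (⊤ : ℕ∞) f) (x : V3) : vrot (grad f) x = 0 := by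
  ext k
  fin_cases k <;> exact sub_eq_zero.2 (pd_comm hf _ _ x)

theorem ContDiff.vrot_apply {v : V3 → V3} (hv : ContDiff ℝ (⊤ : ℕ∞) v) (k : Fin 3) :
    ContDiff ℝ (⊤ : ℕ∞) (fun y => vrot v y k) := by
  have h := contDiff_pi.1 hv
  fin_cases k <;> exact ((h _).pd _).sub ((h _).pd _)

/-- `Rot (sym Grad v) = ½ (Grad (rot v))ᵀ`. -/
theorem mRot_msym_vGrad {v : V3 → V3} (hv : ContDiff ℝ (⊤ : ℕ∞) v) (x : V3) :
    mRot (fun y => msym (vGrad v y)) x = (2⁻¹ : ℝ) • (vGrad (vrot v) x)ᵀ := by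
  have h := contDiff_pi.1 hv
  have hd (i j : Fin 3) : Differentiable ℝ (pd i fun y => v y j) :=
    ((h j).pd i).differentiable (by simp)
  have hsym (i j k : Fin 3) : pd k (fun y => msym (vGrad v y) i j) x =
      2⁻¹ * (pd k (pd j fun y => v y i) x + pd k (pd i fun y => v y j) x) := by
    rw [← pd_add (hd _ _) (hd _ _)]
    exact pd_const_mul ((hd _ _).add (hd _ _)) _ _ _
  have hentry (i a b : Fin 3) :
      pd a (fun y => msym (vGrad v y) i b) x - pd b (fun y => msym (vGrad v y) i a) x =
        2⁻¹ * pd i (fun y => pd a (fun z => v z b) y - pd b (fun z => v z a) y) x := by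
    rw [hsym, hsym, pd_sub (hd _ _) (hd _ _), pd_comm (h i) a b, pd_comm (h b) i a,
      pd_comm (h a) i b]
    ring
  ext i k
  fin_cases k <;> exact hentry i _ _

/-- First complex property of the elasticity complex: `RotRot^⊤ (sym Grad v) = 0`. -/
theorem rotRotT_symGrad_eq_zero (v : V3 → V3) (hv : ContDiff ℝ (⊤ : ℕ∞) v) :
    ∀ x, rotRotT (fun y => msym (vGrad v y)) x = 0 := by
  intro x
  simp only [rotRotT, mRot_msym_vGrad hv, transpose_smul, transpose_transpose]
  ext i k
  have hf := hv.vrot_apply i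
  have hrow : (fun y => ((2⁻¹ : ℝ) • vGrad (vrot v) y) i) =
      grad (fun y => 2⁻¹ * vrot v y i) := by
    funext y j
    exact (pd_const_mul (hf.differentiable (by simp)) _ _ _).symm
  change vrot (fun y => ((2⁻¹ : ℝ) • vGrad (vrot v) y) i) x k = 0
  rw [hrow, vrot_grad (contDiff_const.mul hf)]
  rfl
end

section
/- Let U ⊆ ℝ³ be open and connected and let v : U → ℝ³ be twice continuously differentiable. If sym Grad v = 0 on all of U, then v is the restriction of a rigid motion: there exist a skew-symmetric matrix Q ∈ ℝ^{3×3} and a vector q ∈ ℝ³ such that v(x) = Q x + q for all x ∈ U. -/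
open Matrix

/-- A three-index array that is symmetric in its first two indices and skew in its last two
vanishes. -/
lemma eq_zero_of_symm_of_skew {ι : Type*} {T : ι → ι → ι → ℝ}
    (hsymm : ∀ i j k, T i j k = T j i k) (hskew : ∀ i j k, T i j k = -T i k j) (i j k : ι) :
    T i j k = 0 := by
  linarith [hskew i j k, hsymm i k j, hskew k i j, hsymm k j i, hskew j k i, hsymm j i k]

lemma pd_apply_eq_fderiv {v : V3 → V3} {x : V3} (hv : DifferentiableAt ℝ v x) (i j : Fin 3) :
    pd j (fun y => v y i) x = fderiv ℝ v x (Pi.single j 1) i := by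
  have hi : HasFDerivAt (fun y => v y i) ((ContinuousLinearMap.proj i).comp (fderiv ℝ v x)) x :=
    (ContinuousLinearMap.proj (R := ℝ) (φ := fun _ : Fin 3 => ℝ) i).hasFDerivAt.comp x
      hv.hasFDerivAt
  simp [pd, hi.fderiv]

/-- If `sym Grad v` vanishes at a point, the derivative of `v` there is skew. -/
lemma fderiv_skew_of_msym_vGrad_eq_zero {v : V3 → V3} {x : V3} (hv : DifferentiableAt ℝ v x)
    (h : msym (vGrad v x) = 0) (i j : Fin 3) :
    fderiv ℝ v x (Pi.single j 1) i = -fderiv ℝ v x (Pi.single i 1) j := by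
  have hij := congrFun (congrFun h i) j
  simp only [msym, vGrad, Matrix.smul_apply, Matrix.add_apply, Matrix.transpose_apply,
    Matrix.of_apply, Matrix.zero_apply, smul_eq_mul, pd_apply_eq_fderiv hv] at hij
  linarith

/-- If the derivative of a `C²` field is skew near `x`, its second derivative vanishes at `x`. -/
lemma fderiv_fderiv_eq_zero_of_skew {v : V3 → V3} {x : V3} (hv : ContDiffAt ℝ 2 v x)
    (h : ∀ᶠ y in nhds x, ∀ i j : Fin 3,
      fderiv ℝ v y (Pi.single j 1) i = -fderiv ℝ v y (Pi.single i 1) j) :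
    fderiv ℝ (fderiv ℝ v) x = 0 := by
  have hsymm : IsSymmSndFDerivAt ℝ v x := hv.isSymmSndFDerivAt (by simp)
  have hF : HasFDerivAt (fderiv ℝ v) (fderiv ℝ (fderiv ℝ v) x) x :=
    ((hv.fderiv_right (m := 1) (by norm_num)).differentiableAt (by norm_num)).hasFDerivAt
  have hentry (i j : Fin 3) : HasFDerivAt (fun y => fderiv ℝ v y (Pi.single j 1) i)
      (((ContinuousLinearMap.proj (R := ℝ) (φ := fun _ : Fin 3 => ℝ) i).comp
        (ContinuousLinearMap.apply ℝ V3 (Pi.single j 1 : V3))).comp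
          (fderiv ℝ (fderiv ℝ v) x)) x :=
    ((ContinuousLinearMap.proj (R := ℝ) (φ := fun _ : Fin 3 => ℝ) i).comp
      (ContinuousLinearMap.apply ℝ V3 (Pi.single j 1 : V3))).hasFDerivAt.comp x hF
  have hskew (k j i : Fin 3) : fderiv ℝ (fderiv ℝ v) x (Pi.single k 1) (Pi.single j 1) i =
      -fderiv ℝ (fderiv ℝ v) x (Pi.single k 1) (Pi.single i 1) j := by
    have heq := (hentry i j).unique
      ((hentry j i).neg.congr_of_eventuallyEq (h.mono fun y hy => hy i j))
    simpa using DFunLike.congr_fun heq (Pi.single k 1)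
  have hzero := eq_zero_of_symm_of_skew
    (T := fun k j i => fderiv ℝ (fderiv ℝ v) x (Pi.single k 1) (Pi.single j 1) i)
    (fun k j i => congrFun (hsymm (Pi.single k 1) (Pi.single j 1)) i) hskew
  refine ContinuousLinearMap.coe_injective ((Pi.basisFun ℝ (Fin 3)).ext fun k => ?_)
  refine ContinuousLinearMap.coe_injective ((Pi.basisFun ℝ (Fin 3)).ext fun j => ?_)
  ext i
  simpa using hzero k j i

/-- Rigidity: if `sym Grad v = 0` on an open connected set, then `v` is (the
restriction of) a rigid motion. -/
theorem symGrad_eq_zero_imp_rigid_motion (U : Set V3) (hUopen : IsOpen U)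
    (hUconn : IsConnected U) (v : V3 → V3) (hv : ContDiffOn ℝ 2 v U)
    (h : ∀ x ∈ U, msym (vGrad v x) = 0) :
    ∃ (Q : M3) (q : V3), Qᵀ = -Q ∧ ∀ x ∈ U, v x = Q.mulVec x + q := by
  have hcd (x : V3) (hx : x ∈ U) : ContDiffAt ℝ 2 v x := hv.contDiffAt (hUopen.mem_nhds hx)
  have hdiff (x : V3) (hx : x ∈ U) : DifferentiableAt ℝ v x :=
    (hcd x hx).differentiableAt (by norm_num)
  have hskew (x : V3) (hx : x ∈ U) := fderiv_skew_of_msym_vGrad_eq_zero (hdiff x hx) (h x hx)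
  obtain ⟨L, hL⟩ := hUopen.exists_is_const_of_fderiv_eq_zero (𝕜 := ℝ) (f := fderiv ℝ v)
    hUconn.isPreconnected
    (fun x hx => (((hcd x hx).fderiv_right (m := 1) (by norm_num)).differentiableAt
      (by norm_num)).differentiableWithinAt)
    (fun x hx => fderiv_fderiv_eq_zero_of_skew (hcd x hx)
      (Filter.mem_of_superset (hUopen.mem_nhds hx) hskew))
  obtain ⟨q, hq⟩ := hUopen.exists_is_const_of_fderiv_eq_zero (𝕜 := ℝ) (f := fun x => v x - L x)
    hUconn.isPreconnected
    (fun x hx => ((hdiff x hx).sub L.differentiableAt).differentiableWithinAt)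
    (fun x hx => by
      simp [((hdiff x hx).hasFDerivAt.fun_sub L.hasFDerivAt).fderiv, hL x hx])
  refine ⟨LinearMap.toMatrix' (L : V3 →ₗ[ℝ] V3), q, ?_, fun x hx => ?_⟩
  · obtain ⟨x, hx⟩ := hUconn.nonempty
    ext i j
    have hij := hskew x hx j i
    rw [hL x hx] at hij
    simpa [LinearMap.toMatrix'_apply] using hij
  · rw [LinearMap.toMatrix'_mulVec, ← hq x hx]
    simp
end

section
/- For every smooth vector field v : ℝ³ → ℝ³ one has dev Rot(spn v) = −(dev Grad v)^⊤, where spn v denotes the matrix field x ↦ spn(v(x)). -/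
open Matrix

theorem pd_neg (i : Fin 3) (f : V3 → ℝ) (x : V3) : pd i (fun y => -f y) x = -pd i f x := by
  simp [pd, fderiv_fun_neg]

theorem pd_const (i : Fin 3) (c : ℝ) (x : V3) : pd i (fun _ => c) x = 0 := by
  simp [pd]

/-- `Rot (spn v) = (div v) • Id - (Grad v)ᵀ`. -/
theorem mRot_spn (v : V3 → V3) (x : V3) :
    mRot (fun y => spn (v y)) x = vdiv v x • (1 : M3) - (vGrad v x)ᵀ := by
  ext i j
  fin_cases i <;> fin_cases j <;>
    simp [mRot, vrot, spn, vGrad, vdiv, Fin.sum_univ_three, pd_neg, pd_const] <;> ring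

theorem trace_vGrad (v : V3 → V3) (x : V3) : (vGrad v x).trace = vdiv v x := rfl

/-- `dev Rot (spn v) = -(dev Grad v)ᵀ`. -/
theorem mdev_mRot_spn (v : V3 → V3) (hv : ContDiff ℝ (⊤ : ℕ∞) v) :
    ∀ x, mdev (mRot (fun y => spn (v y)) x) = - (mdev (vGrad v x))ᵀ := by
  intro x
  have htrace : (vdiv v x • (1 : M3) - (vGrad v x)ᵀ).trace / 3 = 2 / 3 * vdiv v x := by
    simp [trace_vGrad]
    ring
  rw [mRot_spn, mdev, htrace, mdev, trace_vGrad, transpose_sub, transpose_smul, transpose_one]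
  module
end

section
/- For every smooth matrix field S : ℝ³ → ℝ^{3×3} one has tr(Rot S) = 2 div(spn⁻¹ skw S); in particular tr(Rot S) = 0 whenever S is pointwise symmetric, and tr Rot(sym S) = 0 as well as tr Rot(skw S) = tr Rot S for arbitrary smooth S. -/
open Matrix

theorem trace_mRot_eq (S : V3 → M3) (x : V3) :
    Matrix.trace (mRot S x) =
      pd 1 (fun y => S y 0 2) x - pd 2 (fun y => S y 0 1) x +
      (pd 2 (fun y => S y 1 0) x - pd 0 (fun y => S y 1 2) x) +
      (pd 0 (fun y => S y 2 1) x - pd 1 (fun y => S y 2 0) x) := by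
  simp [Matrix.trace_fin_three, mRot, vrot]

theorem pd_mskw_apply {S : V3 → M3} {x : V3}
    (hS : ∀ i j, DifferentiableAt ℝ (fun y => S y i j) x) (k i j : Fin 3) :
    pd k (fun y => mskw (S y) i j) x =
      2⁻¹ * (pd k (fun y => S y i j) x - pd k (fun y => S y j i) x) := by
  simp only [pd, mskw, Matrix.smul_apply, Matrix.sub_apply, Matrix.transpose_apply, smul_eq_mul]
  rw [fderiv_const_mul ((hS i j).fun_sub (hS j i)), fderiv_fun_sub (hS i j) (hS j i)]
  simp

theorem vdiv_spnInv (S : V3 → M3) (x : V3) :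
    vdiv (fun y => spnInv (S y)) x =
      pd 0 (fun y => S y 2 1) x + pd 1 (fun y => S y 0 2) x + pd 2 (fun y => S y 1 0) x := by
  simp [vdiv, spnInv, Fin.sum_univ_three]

theorem trace_mRot_of_isSymm {S : V3 → M3} (hS : ∀ x, (S x)ᵀ = S x) (x : V3) :
    Matrix.trace (mRot S x) = 0 := by
  have h (i j : Fin 3) : (fun y => S y i j) = fun y => S y j i :=
    funext fun y => congrFun (congrFun (hS y) j) i
  rw [trace_mRot_eq, h 0 2, h 0 1, h 1 2]
  ring

/-- `tr (Rot S) = 2 div (spn⁻¹ skw S)`; in particular `tr (Rot S) = 0` for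
pointwise symmetric `S`, `tr Rot (sym S) = 0`, and `tr Rot (skw S) = tr Rot S`. -/
theorem trace_mRot (S : V3 → M3)
    (hS : ∀ i j, ContDiff ℝ (⊤ : ℕ∞) fun y => S y i j) :
    (∀ x, Matrix.trace (mRot S x) = 2 * vdiv (fun y => spnInv (mskw (S y))) x) ∧
    ((∀ x, (S x)ᵀ = S x) → ∀ x, Matrix.trace (mRot S x) = 0) ∧
    (∀ x, Matrix.trace (mRot (fun y => msym (S y)) x) = 0) ∧
    (∀ x, Matrix.trace (mRot (fun y => mskw (S y)) x) = Matrix.trace (mRot S x)) := by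
  have hd (x : V3) (i j : Fin 3) : DifferentiableAt ℝ (fun y => S y i j) x :=
    (hS i j).differentiable (by simp) x
  refine ⟨fun x => ?_, trace_mRot_of_isSymm, fun x => ?_, fun x => ?_⟩
  · rw [trace_mRot_eq, vdiv_spnInv (fun y => mskw (S y))]
    simp only [pd_mskw_apply (hd x)]
    ring
  · exact trace_mRot_of_isSymm (fun y => by simp [msym, add_comm]) x
  · rw [trace_mRot_eq, trace_mRot_eq]
    simp only [pd_mskw_apply (hd x)]
    ring
end
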